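/- Every maximally mixed state ω on a unital C*-algebra A vanishes on the strong radical J_A of A (the intersection of all maximal closed two-sided ideals of A). -/

import Mathlib

universe u

open scoped ComplexConjugate ComplexOrder

noncomputable section

variable {A : Type u} [NormedRing A] [StarRing A] [CStarRing A]
  [NormedAlgebra ℂ A] [StarModule ℂ A] [CompleteSpace A]

/-- A linear functional on a C*-algebra is positive if it is nonnegative
on all elements of the form `a* a`. -/
def IsPositiveFunctional (ω : A →L[ℂ] ℂ) : Prop :=
  ∀ a : A, 0 ≤ ω (star a * a)

/-- A state is a positive unital linear functional. -/
def IsState (ω : A →L[ℂ] ℂ) : Prop :=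
  IsPositiveFunctional ω ∧ ω 1 = 1

/-- A hermitian (self-adjoint) linear functional. -/
def IsHermitianFunctional (ω : A →L[ℂ] ℂ) : Prop :=
  ∀ a : A, ω (star a) = conj (ω a)

/-- `ωp`, `ωm` form the Jordan decomposition of the hermitian functional `ω`. -/
def IsJordanDecomposition (ω ωp ωm : A →L[ℂ] ℂ) : Prop :=
  IsPositiveFunctional ωp ∧ IsPositiveFunctional ωm ∧ ω = ωp - ωm ∧ ‖ω‖ = ‖ωp‖ + ‖ωm‖

/-- An element of a C*-algebra is positive iff it is of the form `b* b`. -/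
def IsPositiveElem (c : A) : Prop :=
  ∃ b : A, c = star b * b

/-- `E(A)`: the unital completely positive elementary maps
`x ↦ ∑ i, (a i)* x (a i)` with `∑ i, (a i)* (a i) = 1`. -/
def IsElementaryUCP (φ : A →L[ℂ] A) : Prop :=
  ∃ (n : ℕ) (a : Fin n → A), (∑ i, star (a i) * a i) = 1 ∧
    ∀ x : A, φ x = ∑ i, star (a i) * x * a i

/-- The set `ω ∘ E(A) = {ω ∘ φ : φ ∈ E(A)}`. -/
def mixSet (ω : A →L[ℂ] ℂ) : Set (A →L[ℂ] ℂ) :=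
  {ρ | ∃ φ : A →L[ℂ] A, IsElementaryUCP φ ∧ ρ = ω.comp φ}

/-- Membership in the weak* closure of a set of functionals: every basic weak*
neighbourhood of `ρ` (given by finitely many points and `ε > 0`) meets `S`. -/
def InWeakStarClosure (S : Set (A →L[ℂ] ℂ)) (ρ : A →L[ℂ] ℂ) : Prop :=
  ∀ ε : ℝ, 0 < ε → ∀ (n : ℕ) (x : Fin n → A), ∃ σ ∈ S, ∀ i, ‖ρ (x i) - σ (x i)‖ < ε

/-- Norm-closed two-sided ideals (which in a C*-algebra are automatically
`*`-closed `ℂ`-submodules). -/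
def IsClosedIdeal (J : Set A) : Prop :=
  IsClosed J ∧ (0 : A) ∈ J ∧ (∀ x ∈ J, ∀ y ∈ J, x + y ∈ J) ∧
    (∀ (c : ℂ), ∀ x ∈ J, c • x ∈ J) ∧ (∀ (a : A), ∀ x ∈ J, a * x ∈ J ∧ x * a ∈ J)

/-- The norm `‖ω|J‖` of the restriction of a functional `ω` to a subset `J`. -/
def normRestrict (ω : A →L[ℂ] ℂ) (J : Set A) : ℝ :=
  sSup {r : ℝ | ∃ x ∈ J, ‖x‖ ≤ 1 ∧ r = ‖ω x‖}

/-- The norm `‖cω‖` of the functional `x ↦ ω (c * x)`. -/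
def mulNorm (ω : A →L[ℂ] ℂ) (c : A) : ℝ :=
  sSup {r : ℝ | ∃ x : A, ‖x‖ ≤ 1 ∧ r = ‖ω (c * x)‖}

/-- A state `ω` is maximally mixed if every state `ρ` that is more mixed than `ω`
(i.e. `ρ` lies in the weak* closure of `ω ∘ E(A)`) satisfies in turn that `ω` is
more mixed than `ρ`. -/
def IsMaximallyMixed (ω : A →L[ℂ] ℂ) : Prop :=
  IsState ω ∧ ∀ ρ : A →L[ℂ] ℂ, IsState ρ →
    InWeakStarClosure (mixSet ω) ρ → InWeakStarClosure (mixSet ρ) ω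

/-- Maximal (norm-closed two-sided) ideals. -/
def IsMaximalIdeal (N : Set A) : Prop :=
  IsClosedIdeal N ∧ N ≠ Set.univ ∧
    ∀ N' : Set A, IsClosedIdeal N' → N' ≠ Set.univ → N ⊆ N' → N' = N

/-- The strong radical: the intersection of all maximal ideals. -/
def strongRadical (A : Type u) [NormedRing A] [StarRing A] [CStarRing A]
    [NormedAlgebra ℂ A] [StarModule ℂ A] [CompleteSpace A] : Set A :=
  ⋂₀ {N : Set A | IsMaximalIdeal N}

/-- Algebraic two-sided ideals. -/
def AlgIdeal (J : Set A) : Prop :=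
  (0 : A) ∈ J ∧ (∀ x ∈ J, ∀ y ∈ J, x + y ∈ J) ∧ (∀ (a : A), ∀ x ∈ J, a * x ∈ J ∧ x * a ∈ J)

theorem exists_maximal (G : Set A) (hG : AlgIdeal G) (h1 : (1 : A) ∉ G) :
    ∃ N : Set A, IsMaximalIdeal N ∧ G ⊆ N := by
  obtain ⟨N, hGN, hN⟩ := zorn_subset_nonempty {J : Set A | AlgIdeal J ∧ (1 : A) ∉ J} (by
    intro c hc hch hne
    refine ⟨⋃₀ c, ⟨⟨?_, ?_, ?_⟩, ?_⟩, fun s hs => Set.subset_sUnion_of_mem hs⟩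
    · obtain ⟨s, hs⟩ := hne
      exact ⟨s, hs, (hc hs).1.1⟩
    · rintro x ⟨s, hs, hx⟩ y ⟨t, ht, hy⟩
      rcases hch.total hs ht with h | h
      · exact ⟨t, ht, (hc ht).1.2.1 x (h hx) y hy⟩
      · exact ⟨s, hs, (hc hs).1.2.1 x hx y (h hy)⟩
    · rintro a x ⟨s, hs, hx⟩
      exact ⟨⟨s, hs, ((hc hs).1.2.2 a x hx).1⟩, ⟨s, hs, ((hc hs).1.2.2 a x hx).2⟩⟩
    · rintro ⟨s, hs, hx⟩
      exact (hc hs).2 hx) G ⟨hG, h1⟩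
  obtain ⟨⟨⟨h0, hadd, hmul⟩, hone⟩, hmax⟩ := hN
  have hcl : closure N ⊆ N := by
    refine hmax ⟨⟨subset_closure h0, ?_, ?_⟩, ?_⟩ subset_closure
    · intro x hx y hy
      exact map_mem_closure₂ continuous_add hx hy hadd
    · intro a x hx
      exact ⟨map_mem_closure (continuous_const_mul a) hx (fun z hz => (hmul a z hz).1),
        map_mem_closure (f := fun z => z * a) (continuous_mul_const a) hx (fun z hz => (hmul a z hz).2)⟩
    · intro h
      rw [mem_closure_iff] at h
      obtain ⟨u, hu, huN⟩ := h {x : A | IsUnit x} Units.isOpen isUnit_one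
      obtain ⟨v, rfl⟩ := hu
      apply hone
      have := (hmul (↑v⁻¹ : A) _ huN).1
      simpa using this
  refine ⟨N, ⟨⟨isClosed_of_closure_subset hcl, h0, hadd, ?_, hmul⟩, ?_, ?_⟩, hGN⟩
  · intro c x hx
    have := (hmul (c • 1) x hx).1
    simpa using this
  · intro h
    exact hone (h ▸ Set.mem_univ _)
  · intro N' hN' hne hsub
    refine Set.Subset.antisymm ?_ hsub
    refine hmax ⟨⟨hN'.2.1, hN'.2.2.1, hN'.2.2.2.2⟩, ?_⟩ hsub
    intro h
    apply hne
    ext x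
    have := (hN'.2.2.2.2 x 1 h).1
    simpa using this

section CS
variable {B : Type u} [CStarAlgebra B] [PartialOrder B] [StarOrderedRing B]

/-- The ideal of elements dominated by sums `∑ b* d² b`. -/
def domIdeal (d : B) : Set B :=
  {x | ∃ l : List B, star x * x ≤ (l.map (fun b => star b * (d * d) * b)).sum}

theorem domIdeal_ideal (d : B) : AlgIdeal (domIdeal d) := by
  refine ⟨⟨[], by simp⟩, ?_, ?_⟩
  · rintro x ⟨l, hl⟩ y ⟨m, hm⟩
    refine ⟨(l ++ m) ++ (l ++ m), ?_⟩
    have h : 0 ≤ star (x - y) * (x - y) := star_mul_self_nonneg _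
    have e : star (x + y) * (x + y) + star (x - y) * (x - y)
        = (star x * x + star y * y) + (star x * x + star y * y) := by
      simp only [star_add, star_sub]; noncomm_ring
    calc star (x + y) * (x + y) ≤ star (x + y) * (x + y) + star (x - y) * (x - y) :=
          le_add_of_nonneg_right h
      _ = _ := e
      _ ≤ _ := by
        simp only [List.map_append, List.sum_append]
        gcongr
  · rintro a x ⟨l, hl⟩
    constructor
    · refine ⟨l.map (fun b => ‖a‖ • b), ?_⟩
      calc star (a * x) * (a * x) = star x * (star a * a) * x := by
            simp only [star_mul]; noncomm_ring
        _ ≤ ‖star a * a‖ • (star x * x) :=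
            CStarAlgebra.star_left_conjugate_le_norm_smul (IsSelfAdjoint.star_mul_self a)
        _ ≤ ‖star a * a‖ • (l.map (fun b => star b * (d * d) * b)).sum :=
            smul_le_smul_of_nonneg_left hl (norm_nonneg _)
        _ = _ := by
            rw [CStarRing.norm_star_mul_self, List.smul_sum, List.map_map, List.map_map]
            congr 2
            funext b
            simp [smul_smul]
    · refine ⟨l.map (fun b => b * a), ?_⟩
      calc star (x * a) * (x * a) = star a * (star x * x) * a := by
            simp only [star_mul]; noncomm_ring
        _ ≤ star a * (l.map (fun b => star b * (d * d) * b)).sum * a :=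
            star_left_conjugate_le_conjugate hl a
        _ = _ := by
            rw [← List.sum_map_mul_left, ← List.sum_map_mul_right, List.map_map]
            congr 2
            funext b
            simp only [Function.comp, star_mul]; noncomm_ring

/-- Elements of the strong radical can be mixed to something small. -/
theorem exists_mix (c : B) (hc : 0 ≤ c) (hcJ : c ∈ strongRadical B) (ε : ℝ) (hε : 0 < ε) :
    ∃ φ : B →L[ℂ] B, IsElementaryUCP φ ∧ φ c ≤ ε • (1 : B) := by
  set t : B := ε • (1 : B) - c with ht
  have hsa : IsSelfAdjoint t :=
    ((IsSelfAdjoint.all ε).smul (IsSelfAdjoint.one B)).sub (IsSelfAdjoint.of_nonneg hc)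
  set d : B := t⁺ with hd
  have hd0 : 0 ≤ d := CFC.posPart_nonneg t
  have hdsa : star d = d := (IsSelfAdjoint.of_nonneg hd0).star_eq
  have hm0 : 0 ≤ t⁻ := CFC.negPart_nonneg t
  have hdm : d * t⁻ = 0 := CFC.posPart_mul_negPart t
  have hsub : d - t⁻ = t := CFC.posPart_sub_negPart t hsa
  have hone : (1 : B) ∈ domIdeal d := by
    by_contra h1
    obtain ⟨N, hN, hGN⟩ := exists_maximal _ (domIdeal_ideal d) h1
    have hcN : c ∈ N := hcJ N hN
    have hdN : d ∈ N := hGN ⟨[1], by simp [hdsa]⟩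
    obtain ⟨⟨-, -, hadd, hsm, hmul⟩, hne, -⟩ := hN
    have hs : t⁻ + ε • (1 : B) ∈ N := by
      have : t⁻ + ε • (1 : B) = d + c := by
        have : ε • (1 : B) = t + c := by rw [ht]; abel
        have h2 : d = t + t⁻ := by rw [← sub_eq_iff_eq_add]; exact hsub
        rw [this, h2]; abel
      rw [this]
      exact hadd _ hdN _ hcN
    have hu : IsUnit (t⁻ + ε • (1 : B)) := by
      refine CStarAlgebra.isUnit_of_le (ε • (1 : B)) (le_add_of_nonneg_left hm0) ?_
      exact IsStrictlyPositive.smul hε isStrictlyPositive_one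
    obtain ⟨v, hv⟩ := hu
    apply hne
    ext x
    have := (hmul (x * (↑v⁻¹ : B)) _ hs).1
    rw [← hv] at this
    simpa using this
  obtain ⟨l, hl⟩ := hone
  simp only [star_one, mul_one] at hl
  set S : B := (l.map (fun b => star b * (d * d) * b)).sum with hS
  have hSp : IsStrictlyPositive S := isStrictlyPositive_one.of_le hl
  obtain ⟨r, hr, hrS⟩ : ∃ r : B, star r = r ∧ r * S * r = 1 :=
    ⟨S ^ (-(1 / 2) : ℝ), (IsSelfAdjoint.of_nonneg CFC.rpow_nonneg).star_eq,
      CFC.conjugate_rpow_neg_one_half S hSp⟩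
  have key : ∀ x : B, ∑ i : Fin l.length, star (d * l[i] * r) * x * (d * l[i] * r)
      = r * (l.map (fun b => star b * (d * x * d) * b)).sum * r := by
    intro x
    rw [← Fin.sum_univ_fun_getElem l (fun b => star b * (d * x * d) * b), Finset.mul_sum,
      Finset.sum_mul]
    refine Finset.sum_congr rfl fun i _ => ?_
    simp only [star_mul, hr, hdsa]; noncomm_ring
  refine ⟨∑ i : Fin l.length, (ContinuousLinearMap.mul ℂ B (star (d * l[i] * r))).comp
      ((ContinuousLinearMap.mul ℂ B).flip (d * l[i] * r)),
    ⟨l.length, fun i => d * l[i] * r, ?_, ?_⟩, ?_⟩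
  · have := key 1
    simp only [mul_one] at this
    rw [this, ← hS, hrS]
  · intro x
    simp [mul_assoc]
  · have e : (∑ i : Fin l.length, (ContinuousLinearMap.mul ℂ B (star (d * l[i] * r))).comp
      ((ContinuousLinearMap.mul ℂ B).flip (d * l[i] * r))) c
        = r * (l.map (fun b => star b * (d * c * d) * b)).sum * r := by
      rw [← key]
      simp [mul_assoc]
    rw [e]
    have hdc : d * c * d ≤ ε • (d * d) := by
      have h3 : 0 ≤ star d * d * d := star_left_conjugate_nonneg hd0 d |> fun h => h
      have : ε • (d * d) - d * c * d = star d * d * d := by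
        have h : d * t * d = ε • (d * d) - d * c * d := by
          rw [ht]; simp [mul_sub, sub_mul]
        rw [← h, ← hsub, mul_sub, hdm, sub_zero, hdsa]
      rw [← sub_nonneg, this]; exact h3
    have hsum : (l.map (fun b => star b * (d * c * d) * b)).sum ≤ ε • S := by
      rw [hS, List.smul_sum, List.map_map]
      refine List.sum_le_sum fun b _ => ?_
      have := star_left_conjugate_le_conjugate hdc b
      simpa using this
    calc r * (l.map (fun b => star b * (d * c * d) * b)).sum * r
        = star r * (l.map (fun b => star b * (d * c * d) * b)).sum * r := by rw [hr]
      _ ≤ star r * (ε • S) * r := star_left_conjugate_le_conjugate hsum r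
      _ = ε • (r * S * r) := by rw [hr]; simp
      _ = _ := by rw [hrS]

theorem state_nonneg {ω : B →L[ℂ] ℂ} (h : IsState ω) {x : B} (hx : 0 ≤ x) : 0 ≤ ω x := by
  obtain ⟨y, rfl⟩ := CStarAlgebra.nonneg_iff_eq_star_mul_self.mp hx
  exact h.1 y

theorem state_mono {ω : B →L[ℂ] ℂ} (h : IsState ω) {x y : B} (hx : x ≤ y) : ω x ≤ ω y := by
  have := state_nonneg h (sub_nonneg.mpr hx)
  rw [map_sub] at this
  exact sub_nonneg.mp this

theorem state_star {ω : B →L[ℂ] ℂ} (h : IsState ω) (x : B) : ω (star x) = conj (ω x) := by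
  let p : B →ₚ[ℂ] ℂ := PositiveLinearMap.mk₀ ω.toLinearMap (fun x hx => state_nonneg h hx)
  exact map_star p x

theorem state_cs {ω : B →L[ℂ] ℂ} (h : IsState ω) (x : B) :
    ((‖ω x‖ ^ 2 : ℝ) : ℂ) ≤ ω (star x * x) := by
  have h1 := h.1 (x - (ω x) • 1)
  have e : star (x - (ω x) • (1 : B)) * (x - (ω x) • 1)
      = star x * x - (ω x) • star x - conj (ω x) • x + (conj (ω x) * ω x) • 1 := by
    simp only [star_sub, star_smul, star_one, sub_mul, mul_sub, smul_mul_assoc, mul_smul_comm,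
      one_mul, mul_one, smul_sub, smul_smul, Complex.star_def]
    rw [mul_comm (conj (ω x))]
    abel
  rw [e] at h1
  simp only [map_add, map_sub, map_smul, state_star h, h.2, smul_eq_mul, mul_one] at h1
  have : ((‖ω x‖ ^ 2 : ℝ) : ℂ) = conj (ω x) * ω x := by
    rw [Complex.conj_mul']; push_cast; rfl
  rw [this, ← sub_nonneg]
  convert h1 using 1
  ring

theorem state_norm {ω : B →L[ℂ] ℂ} (h : IsState ω) : ‖ω‖ ≤ 1 := by
  refine ω.opNorm_le_bound zero_le_one fun x => ?_
  have h1 := state_cs h x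
  have h2 : ω (star x * x) ≤ ((‖x‖ ^ 2 : ℝ) : ℂ) := by
    have := state_mono h (CStarAlgebra.star_mul_le_algebraMap_norm_sq (a := x))
    rw [Algebra.algebraMap_eq_smul_one] at this
    rw [← Complex.coe_smul, map_smul, h.2] at this
    simpa using this
  have h3 : ‖ω x‖ ^ 2 ≤ ‖x‖ ^ 2 := by exact_mod_cast h1.trans h2
  rw [one_mul]
  exact le_of_sq_le_sq h3 (norm_nonneg _)

theorem state_comp {ω : B →L[ℂ] ℂ} (h : IsState ω) {φ : B →L[ℂ] B} (hφ : IsElementaryUCP φ) :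
    IsState (ω.comp φ) := by
  obtain ⟨n, a, h1, hx⟩ := hφ
  refine ⟨fun b => ?_, ?_⟩
  · rw [ContinuousLinearMap.comp_apply, hx]
    exact state_nonneg h (Finset.sum_nonneg fun i _ =>
      star_left_conjugate_nonneg (star_mul_self_nonneg b) _)
  · rw [ContinuousLinearMap.comp_apply, hx]
    simp [h1, h.2]

theorem closedIdeal_radical : IsClosedIdeal (strongRadical B) := by
  refine ⟨isClosed_sInter fun N hN => hN.1.1, fun N hN => hN.1.2.1,
    fun x hx y hy N hN => hN.1.2.2.1 x (hx N hN) y (hy N hN),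
    fun c x hx N hN => hN.1.2.2.2.1 c x (hx N hN),
    fun a x hx => ⟨fun N hN => (hN.1.2.2.2.2 a x (hx N hN)).1,
      fun N hN => (hN.1.2.2.2.2 a x (hx N hN)).2⟩⟩

theorem radical_sum {ι : Type*} (s : Finset ι) (f : ι → B) (h : ∀ i ∈ s, f i ∈ strongRadical B) :
    ∑ i ∈ s, f i ∈ strongRadical B :=
  Finset.sum_induction f (· ∈ strongRadical B)
    (fun x y hx hy => closedIdeal_radical.2.2.1 x hx y hy) closedIdeal_radical.2.1 h

theorem exists_mixed_state (ω : B →L[ℂ] ℂ) (hω : IsState ω) :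
    ∃ ρ : B →L[ℂ] ℂ, IsState ρ ∧ InWeakStarClosure (mixSet ω) ρ ∧
      ∀ x ∈ strongRadical B, ρ x = 0 := by
  classical
  have step : ∀ p : Finset (strongRadical B) × ℕ, ∃ σ ∈ mixSet ω, IsState σ ∧
      ∀ x ∈ p.1, ‖σ x‖ ^ 2 ≤ 1 / ((p.2 : ℝ) + 1) := by
    rintro ⟨s, n⟩
    obtain ⟨φ, hφ, hle⟩ := exists_mix (∑ x ∈ s, star (x : B) * x)
      (Finset.sum_nonneg fun x _ => star_mul_self_nonneg _)
      (radical_sum _ _ fun x _ => (closedIdeal_radical.2.2.2.2 _ _ x.2).1)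
      (1 / ((n : ℝ) + 1)) (by positivity)
    have hst := state_comp hω hφ
    refine ⟨ω.comp φ, ⟨φ, hφ, rfl⟩, hst, fun x hx => ?_⟩
    have h1 := state_cs hst (x : B)
    have h2 : (ω.comp φ) (star (x : B) * x) ≤ (ω.comp φ) (∑ x ∈ s, star (x : B) * x) :=
      state_mono hst (Finset.single_le_sum (f := fun x : strongRadical B => star (x : B) * x)
        (fun x _ => star_mul_self_nonneg (x : B)) hx)
    have h3 := state_mono hω hle
    rw [← Complex.coe_smul, map_smul, hω.2, smul_eq_mul, mul_one] at h3
    exact_mod_cast h1.trans (h2.trans h3)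
  choose σ hσ hσs hσx using step
  let U : Ultrafilter (Finset (strongRadical B) × ℕ) := Ultrafilter.of Filter.atTop
  have hU : (U : Filter (Finset (strongRadical B) × ℕ)) ≤ Filter.atTop := Ultrafilter.of_le _
  obtain ⟨ρ', -, hρ⟩ := (WeakDual.isCompact_closedBall (𝕜 := ℂ) (E := B) 0 1).ultrafilter_le_nhds
    (U.map fun p => StrongDual.toWeakDual (σ p)) (by
      rw [Filter.le_principal_iff, Ultrafilter.mem_coe, Ultrafilter.mem_map]
      refine Filter.Eventually.of_forall fun p => ?_
      simpa using state_norm (hσs p))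
  let ρ : B →L[ℂ] ℂ := WeakDual.toStrongDual ρ'
  have hlim : ∀ x : B, Filter.Tendsto (fun p => σ p x) U (nhds (ρ x)) := by
    intro x
    have : Filter.Tendsto (fun p => StrongDual.toWeakDual (σ p)) U (nhds ρ') := hρ
    exact ((WeakDual.eval_continuous x).tendsto ρ').comp this
  refine ⟨ρ, ⟨fun a => ?_, ?_⟩, ?_, ?_⟩
  · exact ge_of_tendsto' (hlim _) fun p => (hσs p).1 a
  · refine tendsto_nhds_unique (hlim 1) ?_
    simp only [(hσs _).2]
    exact tendsto_const_nhds
  · intro ε hε n x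
    have : ∀ᶠ p in (U : Filter _), ∀ i, ‖ρ (x i) - σ p (x i)‖ < ε := by
      rw [Filter.eventually_all]
      intro i
      have := (Metric.tendsto_nhds.mp (hlim (x i))) ε hε
      filter_upwards [this] with p hp
      rwa [dist_comm, dist_eq_norm] at hp
    obtain ⟨p, hp⟩ := this.exists
    exact ⟨σ p, hσ p, hp⟩
  · intro x hx
    have h1 : Filter.Tendsto (fun p => ‖σ p x‖ ^ 2) U (nhds (‖ρ x‖ ^ 2)) := (hlim x).norm.pow 2
    have h2 : Filter.Tendsto (fun p : Finset (strongRadical B) × ℕ => 1 / ((p.2 : ℝ) + 1)) U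
        (nhds 0) := by
      refine (tendsto_one_div_add_atTop_nhds_zero_nat (𝕜 := ℝ)).comp ?_
      refine Filter.Tendsto.mono_left ?_ hU
      rw [← Filter.prod_atTop_atTop_eq]
      exact Filter.tendsto_snd
    have h3 : ∀ᶠ p in (U : Filter _), ‖σ p x‖ ^ 2 ≤ 1 / ((p.2 : ℝ) + 1) := by
      refine hU ?_
      filter_upwards [Filter.eventually_ge_atTop (({⟨x, hx⟩}, 0) : Finset (strongRadical B) × ℕ)]
        with p hp
      exact hσx p ⟨x, hx⟩ (hp.1 (Finset.mem_singleton_self _))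
    have h4 := le_of_tendsto_of_tendsto h1 h2 h3
    have h5 : ‖ρ x‖ = 0 := by
      have := sq_nonneg ‖ρ x‖
      exact pow_eq_zero_iff (two_ne_zero) |>.mp (le_antisymm h4 this)
    exact norm_eq_zero.mp h5

theorem main_aux (ω : B →L[ℂ] ℂ) (hω : IsMaximallyMixed ω) :
    ∀ x ∈ strongRadical B, ω x = 0 := by
  intro x hx
  obtain ⟨ρ, hρ, hcl, hv⟩ := exists_mixed_state ω hω.1
  have h := hω.2 ρ hρ hcl
  by_contra hne
  obtain ⟨σ, ⟨φ, ⟨n, a, -, hφ⟩, rfl⟩, hlt⟩ := h ‖ω x‖ (norm_pos_iff.mpr hne) 1 (fun _ => x)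
  have hz : ρ (φ x) = 0 := by
    apply hv
    rw [hφ]
    refine radical_sum _ _ fun i _ => ?_
    exact (closedIdeal_radical.2.2.2.2 _ _ (closedIdeal_radical.2.2.2.2 _ _ hx).1).2
  have := hlt 0
  simp [hz] at this

end CS

/-- **Theorem.** Every maximally mixed state on a unital C*-algebra vanishes on
the strong radical (the intersection of all maximal closed two-sided ideals). -/
theorem maximallyMixed_annihilates_strongRadical
    (ω : A →L[ℂ] ℂ) (hω : IsMaximallyMixed ω) :
    ∀ x ∈ strongRadical A, ω x = 0 := by
  letI : CStarAlgebra A :=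
    { ‹NormedRing A›, ‹StarRing A›, ‹CompleteSpace A›, ‹CStarRing A›, ‹NormedAlgebra ℂ A›,
      ‹StarModule ℂ A› with }
  letI : PartialOrder A := CStarAlgebra.spectralOrder A
  haveI : StarOrderedRing A := CStarAlgebra.spectralOrderedRing A
  exact main_aux (B := A) ω hω

end
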